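/- Let n > t ≥ 0 and X a set with |X| ≥ 2. If B_1,…,B_m are Hamming balls of radius t in X^n, then there exists a subset I ⊆ [m] of size at most 2^{t+1} such that the intersection of all the B_i equals the intersection of the B_i for i ∈ I. -/

import Mathlib

open Finset in
/-- Triangular criterion: the products `∏ k, (u x k - v y k)` form a matrix that factors through
the `2 ^ n`-dimensional space of multi-affine polynomials. -/
theorem card_le_two_pow_of_triangular {α : Type*} [Fintype α] {n : ℕ}
    (u v : α → Fin n → ℚ) (level : α → ℕ) (hdiag : ∀ x k, u x k ≠ v x k)
    (hoff : ∀ x y, x ≠ y → level x ≤ level y → ∃ k, u x k = v y k) :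
    Fintype.card α ≤ 2 ^ n := by
  classical
  let P : α → Finset (Fin n) → ℚ := fun x Z => ∏ k ∈ Z, u x k
  have hP : LinearIndependent ℚ P := by
    rw [Fintype.linearIndependent_iff]
    intro c hc
    have hzero : ∀ y, ∑ x, c x * ∏ k, (u x k - v y k) = 0 := by
      intro y
      have hexp : ∀ x, ∏ k, (u x k - v y k) =
          ∑ Z : Finset (Fin n), P x Z * ∏ k ∈ univ \ Z, (- v y k) := by
        intro x
        simp only [sub_eq_add_neg, Finset.prod_add, Finset.powerset_univ, P]
      simp only [hexp, Finset.mul_sum]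
      rw [Finset.sum_comm]
      refine Finset.sum_eq_zero fun Z _ => ?_
      have := congrFun hc Z
      simp only [Finset.sum_apply, Pi.smul_apply, smul_eq_mul, Pi.zero_apply] at this
      simp only [← mul_assoc, ← Finset.sum_mul, this, zero_mul]
    by_contra! hne
    obtain ⟨z, hz⟩ := hne
    obtain ⟨y, hy, hmax⟩ := Finset.exists_max_image (univ.filter fun x => c x ≠ 0) level
      ⟨z, by simpa using hz⟩
    simp only [mem_filter, mem_univ, true_and] at hy hmax
    have h := hzero y
    rw [Finset.sum_eq_single y] at h
    · rcases mul_eq_zero.1 h with h | h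
      · exact hy h
      · obtain ⟨k, -, hk⟩ := Finset.prod_eq_zero_iff.1 h
        exact hdiag y k (sub_eq_zero.1 hk)
    · intro x _ hxy
      by_cases hx : c x = 0
      · simp [hx]
      · obtain ⟨k, hk⟩ := hoff x y hxy (hmax x hx)
        rw [Finset.prod_eq_zero (mem_univ k) (sub_eq_zero.2 hk), mul_zero]
    · simp
  simpa using hP.fintype_card_le_finrank

/-- The weight of a set of coordinates: to leading order its size, with ties broken in favour of
sets containing large coordinates. -/
def coordWeight {n : ℕ} (F : Finset (Fin n)) : ℕ := ∑ k ∈ F, (2 ^ n - 2 ^ (k : ℕ))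

theorem coordWeight_add_sum {n : ℕ} (F : Finset (Fin n)) :
    coordWeight F + ∑ k ∈ F, 2 ^ (k : ℕ) = 2 ^ n * F.card := by
  rw [coordWeight, ← Finset.sum_add_distrib, Finset.sum_congr rfl (g := fun _ => 2 ^ n)]
  · simp [mul_comm]
  · intro k _
    have : 2 ^ (k : ℕ) ≤ 2 ^ n := Nat.pow_le_pow_right (by norm_num) k.2.le
    omega

theorem coordWeight_mono {n : ℕ} {F G : Finset (Fin n)} (h : F ⊆ G) :
    coordWeight F ≤ coordWeight G := Finset.sum_le_sum_of_subset h

theorem coordWeight_union_le {n : ℕ} (F G : Finset (Fin n)) :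
    coordWeight (F ∪ G) ≤ coordWeight F + coordWeight G := by
  have := Finset.sum_union_inter (s₁ := F) (s₂ := G) (f := fun k : Fin n => 2 ^ n - 2 ^ (k : ℕ))
  simp only [coordWeight]
  omega

theorem coordWeight_union_of_disjoint {n : ℕ} {F G : Finset (Fin n)} (h : Disjoint F G) :
    coordWeight (F ∪ G) = coordWeight F + coordWeight G := Finset.sum_union h

theorem sum_two_pow_univ_fin (n : ℕ) : ∑ k : Fin n, 2 ^ (k : ℕ) + 1 = 2 ^ n := by
  induction n with
  | zero => simp
  | succ n ih =>
    rw [Fin.sum_univ_castSucc]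
    simp only [Fin.val_castSucc, Fin.val_last]
    rw [pow_succ]
    omega

theorem lt_coordWeight_of_lt_card {n N : ℕ} {A : Finset (Fin n)} (h : N < A.card) :
    2 ^ n * N < coordWeight A := by
  have h1 := coordWeight_add_sum A
  have h2 := sum_two_pow_univ_fin n
  have h3 : ∑ k ∈ A, 2 ^ (k : ℕ) ≤ ∑ k : Fin n, 2 ^ (k : ℕ) :=
    Finset.sum_le_sum_of_subset (Finset.subset_univ A)
  have h4 : 2 ^ n * (N + 1) ≤ 2 ^ n * A.card := Nat.mul_le_mul_left _ h
  rw [mul_add, mul_one] at h4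
  omega

open Finset in
/-- If every coordinate above `d ∈ H` lies in `C`, the binary values of `C` and of two copies
of `H` add up to at least `2 ^ n`. -/
theorem two_pow_le_sum_add_two_mul_sum {n : ℕ} {C H : Finset (Fin n)} {d : Fin n} (hd : d ∈ H)
    (hC : ∀ k, d < k → k ∈ C) :
    2 ^ n ≤ ∑ k ∈ C, 2 ^ (k : ℕ) + 2 * ∑ k ∈ H, 2 ^ (k : ℕ) := by
  have hsub : (univ : Finset (Fin n)) ⊆ C ∪ univ.filter (· ≤ d) := by
    intro k _
    rcases lt_or_ge d k with h | h
    · exact mem_union_left _ (hC k h)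
    · exact mem_union_right _ (by simpa using h)
  have h1 : ∑ k : Fin n, 2 ^ (k : ℕ) ≤
      ∑ k ∈ C, 2 ^ (k : ℕ) + ∑ k ∈ univ.filter (· ≤ d), 2 ^ (k : ℕ) := by
    refine (sum_le_sum_of_subset hsub).trans ?_
    rw [← sum_union_inter]
    exact Nat.le_add_right _ _
  have h2 : ∑ k ∈ univ.filter (· ≤ d), 2 ^ (k : ℕ) < 2 * 2 ^ (d : ℕ) := by
    rw [← pow_succ', ← sum_image (s := univ.filter (· ≤ d)) (g := fun k : Fin n => (k : ℕ))
      (f := fun j => 2 ^ j) (fun x _ y _ h => Fin.ext h)]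
    refine Nat.geomSum_lt le_rfl fun j hj => ?_
    simp only [mem_image, mem_filter, mem_univ, true_and] at hj
    obtain ⟨k, hk, rfl⟩ := hj
    exact Nat.lt_succ_of_le hk
  have h3 : 2 ^ (d : ℕ) ≤ ∑ k ∈ H, 2 ^ (k : ℕ) :=
    single_le_sum (f := fun k : Fin n => 2 ^ (k : ℕ)) (fun _ _ => Nat.zero_le _) hd
  have h4 := sum_two_pow_univ_fin n
  omega

/-- The subsets of the complement of `C` light enough to be free on both sides of the pairing. -/
def lightSets {n : ℕ} (N : ℕ) (C : Finset (Fin n)) : Finset (Finset (Fin n)) :=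
  (Cᶜ).powerset.filter fun H => 2 * coordWeight H + coordWeight C ≤ 2 ^ n * N

open Finset in
theorem mem_lightSets_of_card {n N : ℕ} {C H : Finset (Fin n)} {d : Fin n} (hH : H ⊆ Cᶜ)
    (hC : ∀ k, d < k → k ∈ C)
    (hcard : 2 * H.card + C.card ≤ N ∨ 2 * H.card + C.card ≤ N + 1 ∧ d ∈ H) :
    H ∈ lightSets N C := by
  rw [lightSets, mem_filter, mem_powerset]
  refine ⟨hH, ?_⟩
  have h1 := coordWeight_add_sum H
  have h2 := coordWeight_add_sum C
  rcases hcard with h | ⟨h, hd⟩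
  · have := Nat.mul_le_mul_left (2 ^ n) h
    rw [mul_add, mul_left_comm] at this
    omega
  · have := Nat.mul_le_mul_left (2 ^ n) h
    rw [mul_add, mul_left_comm, mul_add, mul_one] at this
    have := two_pow_le_sum_add_two_mul_sum hd hC
    omega

open Finset in
/-- There are at least `2 ^ (N - |C|)` light sets: in a set of `N - |C| + 1` coordinates containing
the largest element of `Cᶜ`, one of any two complementary subsets is light. -/
theorem two_pow_le_card_lightSets {n N : ℕ} (C : Finset (Fin n)) (hCN : C.card ≤ N) (hN : N < n) :
    2 ^ N ≤ 2 ^ C.card * (lightSets N C).card := by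
  have hcompl : (Cᶜ).card = n - C.card := by simp [card_compl]
  have hne : (Cᶜ).Nonempty := card_pos.1 (by omega)
  obtain ⟨d, hdC, hdmax⟩ := exists_max_image (Cᶜ) id hne
  have hC : ∀ k, d < k → k ∈ C := by
    intro k hk
    by_contra hkC
    exact absurd (hdmax k (mem_compl.2 hkC)) (not_le.2 hk)
  obtain ⟨D, hdD, hDC, hD⟩ := exists_subsuperset_card_eq (s := {d}) (t := Cᶜ)
    (n := N - C.card + 1) (by simpa using hdC) (by simp) (by omega)
  rw [singleton_subset_iff] at hdD
  have hcover : D.powerset ⊆ lightSets N C ∪ (lightSets N C).image (D \ ·) := by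
    intro H hH
    rw [mem_powerset] at hH
    have hsum := card_sdiff_add_card_eq_card hH
    have hinv : D \ (D \ H) = H := by rw [sdiff_sdiff_right_self]; exact inf_eq_right.2 hH
    have hlight : H ∈ lightSets N C ∨ D \ H ∈ lightSets N C := by
      rcases lt_trichotomy H.card (D \ H).card with h | h | h
      · exact Or.inl (mem_lightSets_of_card (hH.trans hDC) hC (Or.inl (by omega)))
      · by_cases hdH : d ∈ H
        · exact Or.inl (mem_lightSets_of_card (hH.trans hDC) hC (Or.inr ⟨by omega, hdH⟩))
        · exact Or.inr (mem_lightSets_of_card (sdiff_subset.trans hDC) hC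
            (Or.inr ⟨by omega, mem_sdiff.2 ⟨hdD, hdH⟩⟩))
      · exact Or.inr (mem_lightSets_of_card (sdiff_subset.trans hDC) hC (Or.inl (by omega)))
    rcases hlight with h | h
    · exact mem_union_left _ h
    · exact mem_union_right _ (mem_image.2 ⟨_, h, hinv⟩)
  have hcard := (card_le_card hcover).trans (card_union_le _ _)
  rw [card_powerset, hD, pow_succ] at hcard
  have himage : ((lightSets N C).image (D \ ·)).card ≤ (lightSets N C).card := card_image_le
  calc 2 ^ N = 2 ^ C.card * 2 ^ (N - C.card) := by rw [← pow_add]; congr 1; omega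
    _ ≤ _ := Nat.mul_le_mul_left _ (by omega)

open Finset in
/-- Rational vectors `a i`, `b i` such that `a i` and `b i` agree in at most `N` coordinates while
`a i` and `b j` agree in more than `N` coordinates for `i ≠ j`. -/
theorem card_mul_two_pow_le {ι : Type*} [Fintype ι] {n N : ℕ} (hN : N < n)
    (a b : ι → Fin n → ℚ) (γ : ℚ) (hγ : ∀ i k, a i k ≠ γ)
    (hdiag : ∀ i, (univ.filter fun k => a i k = b i k).card ≤ N)
    (hoff : ∀ i j, i ≠ j → N < (univ.filter fun k => a i k = b j k).card) :
    Fintype.card ι * 2 ^ N ≤ 2 ^ n := by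
  classical
  let C : ι → Finset (Fin n) := fun i => univ.filter fun k => a i k = b i k
  have hC : ∀ i k, k ∈ C i ↔ a i k = b i k := by simp [C]
  let s : Finset (Σ _ : ι, Finset (Fin n) × Finset (Fin n)) :=
    univ.sigma fun i => (C i).powerset ×ˢ lightSets N (C i)
  have hs : Fintype.card ι * 2 ^ N ≤ s.card := by
    rw [card_sigma, ← card_univ, ← smul_eq_mul]
    refine card_nsmul_le_sum _ _ _ fun i _ => ?_
    rw [card_product, card_powerset]
    exact two_pow_le_card_lightSets (C i) (hdiag i) hN
  have hmem : ∀ x : s, x.1.2.1 ⊆ C x.1.1 ∧ x.1.2.2 ⊆ (C x.1.1)ᶜ ∧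
      2 * coordWeight x.1.2.2 + coordWeight (C x.1.1) ≤ 2 ^ n * N := by
    rintro ⟨⟨i, S, H⟩, hx⟩
    simpa [s, lightSets] using hx
  refine hs.trans ?_
  rw [← Fintype.card_coe]
  refine card_le_two_pow_of_triangular
    (fun x k => if k ∈ x.1.2.1 then γ else if k ∈ x.1.2.2 then b x.1.1 k else a x.1.1 k)
    (fun x k => if k ∈ C x.1.1 \ x.1.2.1 then γ
      else if k ∈ x.1.2.2 then a x.1.1 k else b x.1.1 k)
    (fun x => coordWeight (x.1.2.1 ∪ x.1.2.2)) ?_ ?_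
  · rintro x k
    obtain ⟨h1, h2, -⟩ := hmem x
    have h1 := @h1 k
    have h2 := @h2 k
    have h3 := hC x.1.1 k
    have h4 := hγ x.1.1 k
    simp only [mem_sdiff, mem_compl] at h1 h2 ⊢
    grind
  · rintro ⟨⟨i, S, H⟩, hx⟩ ⟨⟨j, S', H'⟩, hy⟩ hxy hlevel
    obtain ⟨hS, hH, hw⟩ := hmem ⟨_, hx⟩
    obtain ⟨hS', hH', hw'⟩ := hmem ⟨_, hy⟩
    simp only at hS hH hw hS' hH' hw' hlevel ⊢
    by_cases hij : i = j
    · subst hij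
      have hne : ∃ k, ¬ ((k ∈ S ↔ k ∈ S') ∧ (k ∈ H ↔ k ∈ H')) := by
        by_contra! h
        exact hxy (by
          rw [Subtype.mk.injEq, Finset.ext fun k => (h k).1, Finset.ext fun k => (h k).2])
      obtain ⟨k, hk⟩ := hne
      refine ⟨k, ?_⟩
      have h1 := @hS k
      have h2 := @hH k
      have h1' := @hS' k
      have h2' := @hH' k
      have h3 := hC i k
      simp only [mem_sdiff, mem_compl] at h1 h2 h1' h2' ⊢
      grind
    · let F := S ∪ H
      let G := (C j \ S') ∪ H'
      have hweight : coordWeight (F ∪ G) ≤ 2 ^ n * N := by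
        have e1 := coordWeight_union_of_disjoint (F := S') (G := C j \ S') disjoint_sdiff
        rw [union_sdiff_of_subset hS'] at e1
        have e2 := coordWeight_union_le F G
        have e3 := coordWeight_union_le (C j \ S') H'
        have e4 := coordWeight_union_le S' H'
        simp only [F, G] at e2 e3 ⊢
        omega
      have hnot : ¬ (univ.filter fun k => a i k = b j k) ⊆ F ∪ G := fun hsub =>
        absurd (lt_coordWeight_of_lt_card (hoff i j hij))
          (not_lt.2 ((coordWeight_mono hsub).trans hweight))
      obtain ⟨k, hk, hkFG⟩ := not_subset.1 hnot
      simp only [mem_filter, mem_univ, true_and] at hk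
      simp only [F, G, mem_union, not_or] at hkFG
      refine ⟨k, ?_⟩
      rw [if_neg hkFG.1.1, if_neg hkFG.1.2, if_neg hkFG.2.1, if_neg hkFG.2.2, hk]

open Finset in
theorem card_agree_add_hammingDist {X : Type*} [DecidableEq X] {n : ℕ} (p q : Fin n → X) :
    (univ.filter fun k => p k = q k).card + hammingDist p q = n := by
  simpa [hammingDist] using card_filter_add_card_filter_not (s := univ) (fun k => p k = q k)

open Finset in
/-- Set-pair inequality for the Hamming distance. -/
theorem card_le_two_pow_of_hammingDist {ι X : Type*} [Fintype ι] [DecidableEq X] {n t : ℕ}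
    (ht : t < n) (a b : ι → Fin n → X) (hdiag : ∀ i, t < hammingDist (a i) (b i))
    (hoff : ∀ i j, i ≠ j → hammingDist (a i) (b j) ≤ t) :
    Fintype.card ι ≤ 2 ^ (t + 1) := by
  let V : Set X := Set.range (fun q : ι × Fin n => a q.1 q.2) ∪
    Set.range (fun q : ι × Fin n => b q.1 q.2)
  have hV : V.Countable := ((Set.finite_range _).union (Set.finite_range _)).countable
  obtain ⟨f, hf⟩ := Set.countable_iff_exists_injOn.1 hV
  have hinj : ∀ i j k, ((f (a i k) : ℚ) = f (b j k) ↔ a i k = b j k) := by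
    intro i j k
    rw [Nat.cast_inj]
    exact hf.eq_iff (Or.inl ⟨(i, k), rfl⟩) (Or.inr ⟨(j, k), rfl⟩)
  have h := card_mul_two_pow_le (N := n - (t + 1)) (by omega) (fun i k => (f (a i k) : ℚ))
    (fun i k => (f (b i k) : ℚ)) (-1)
    (fun i k => by have : (0 : ℚ) ≤ f (a i k) := Nat.cast_nonneg _; linarith)
    (fun i => by
      simp only [hinj]
      have := card_agree_add_hammingDist (a i) (b i)
      have := hdiag i
      omega)
    (fun i j hij => by
      simp only [hinj]
      have := card_agree_add_hammingDist (a i) (b j)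
      have := hoff i j hij
      omega)
  refine Nat.le_of_mul_le_mul_right (h.trans_eq ?_) (pow_pos two_pos (n - (t + 1)))
  rw [← pow_add]
  congr 1
  omega

theorem stmt_2 (n t : ℕ) (ht : t < n) (X : Type*) [DecidableEq X]
    (hX : ∃ x y : X, x ≠ y) (m : ℕ) (a : Fin m → (Fin n → X)) :
    ∃ I : Finset (Fin m), I.card ≤ 2 ^ (t + 1) ∧
      (⋂ i, {p : Fin n → X | hammingDist p (a i) ≤ t}) =
        ⋂ i ∈ I, {p : Fin n → X | hammingDist p (a i) ≤ t} := by
  classical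
  obtain ⟨I, hI, hmin⟩ := Finset.exists_min_image
    (Finset.univ.filter fun I : Finset (Fin m) =>
      (⋂ i, {p : Fin n → X | hammingDist p (a i) ≤ t}) =
        ⋂ i ∈ I, {p : Fin n → X | hammingDist p (a i) ≤ t})
    Finset.card ⟨Finset.univ, by simp⟩
  simp only [Finset.mem_filter, Finset.mem_univ, true_and] at hI hmin
  refine ⟨I, ?_, hI⟩
  have hwitness : ∀ i : I, ∃ p : Fin n → X, t < hammingDist (a i) p ∧
      ∀ j ∈ I, j ≠ i → hammingDist (a j) p ≤ t := by
    intro i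
    by_contra! hno
    refine absurd (hmin (I.erase i) ?_) (not_le.2 (Finset.card_erase_lt_of_mem i.2))
    rw [hI]
    ext p
    simp only [Set.mem_iInter, Set.mem_ofPred_eq, Finset.mem_erase]
    refine ⟨fun h j hj => h j hj.2, fun h => ?_⟩
    have hi : hammingDist (a i) p ≤ t := by
      by_contra! hlt
      obtain ⟨j, hj, hji, hjt⟩ := hno p hlt
      exact absurd (h j ⟨hji, hj⟩) (not_le.2 (by rwa [hammingDist_comm]))
    intro j hj
    by_cases hji : j = i
    · rw [hji, hammingDist_comm]
      exact hi
    · exact h j ⟨hji, hj⟩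
  choose b hfar hnear using hwitness
  simpa using card_le_two_pow_of_hammingDist ht (fun i : I => a i) b hfar
    fun i j hij => hnear j i i.2 fun h => hij (Subtype.ext h)
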